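/- Let L > 0 and Ra ∈ ℝ, and let (θ', θ̄, u, v, w, ω, ψ) be a smooth solution of the infinite-Prandtl-number convection system on ℝ³ × [0,∞) (as specified in the context). Then the temperature fluctuation decays exponentially: ‖θ'(·,t)‖₂² ≤ e^{−(2/L²) t} ‖θ'(·,0)‖₂² for all t ≥ 0. -/

import Mathlib

noncomputable section
open Real

/-- Functions of `(x, y, z, t)`. -/
abbrev F4 := ℝ → ℝ → ℝ → ℝ → ℝ

def px (f : F4) : F4 := fun x y z t => deriv (fun s => f s y z t) x
def py (f : F4) : F4 := fun x y z t => deriv (fun s => f x s z t) y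
def pz (f : F4) : F4 := fun x y z t => deriv (fun s => f x y s t) z
def pt (f : F4) : F4 := fun x y z t => deriv (fun s => f x y z s) t

/-- Horizontal Laplacian `Δ_h = ∂²_x + ∂²_y`. -/
def lapH (f : F4) : F4 := fun x y z t => px (px f) x y z t + py (py f) x y z t

/-- The horizontal mean `(1/(4π²L²)) ∫_{[0,2πL]²} f dx dy`. -/
def hmean (L : ℝ) (f : F4) (z t : ℝ) : ℝ :=
  (1/(4*π^2*L^2)) * ∫ y in (0:ℝ)..(2*π*L), ∫ x in (0:ℝ)..(2*π*L), f x y z t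

/-- Smoothness on `ℝ³ × D` (jointly in all four variables). -/
def SmoothF4 (f : F4) (D : Set ℝ) : Prop :=
  ContDiffOn ℝ (⊤ : ℕ∞) (fun p : ℝ × ℝ × ℝ × ℝ => f p.1 p.2.1 p.2.2.1 p.2.2.2)
    {p : ℝ × ℝ × ℝ × ℝ | p.2.2.2 ∈ D}

/-- Spatial periodicity: period `2πL` in `x` and `y`, period `2π` in `z`. -/
def PeriodicF4 (L : ℝ) (f : F4) : Prop :=
  (∀ x y z t, f (x + 2*π*L) y z t = f x y z t) ∧
  (∀ x y z t, f x (y + 2*π*L) z t = f x y z t) ∧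
  (∀ x y z t, f x y (z + 2*π) t = f x y z t)

/-- A smooth solution of the infinite-Prandtl-number rapidly rotating convection system
on `ℝ³ × D`. -/
structure IsSolution (L Ra : ℝ) (D : Set ℝ)
    (θ' : F4) (θb : ℝ → ℝ → ℝ) (u v w ω ψ : F4) : Prop where
  smooth_θ' : SmoothF4 θ' D
  smooth_u : SmoothF4 u D
  smooth_v : SmoothF4 v D
  smooth_w : SmoothF4 w D
  smooth_ω : SmoothF4 ω D
  smooth_ψ : SmoothF4 ψ D
  smooth_θb : ContDiffOn ℝ (⊤ : ℕ∞) (fun p : ℝ × ℝ => θb p.1 p.2) {p : ℝ × ℝ | p.2 ∈ D}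
  per_θ' : PeriodicF4 L θ'
  per_u : PeriodicF4 L u
  per_v : PeriodicF4 L v
  per_w : PeriodicF4 L w
  per_ω : PeriodicF4 L ω
  per_ψ : PeriodicF4 L ψ
  per_θb : ∀ z t, θb (z + 2*π) t = θb z t
  /-- `∂_z ψ = Ra θ' + Δ_h w` -/
  eq_psi : ∀ x y z : ℝ, ∀ t ∈ D, pz ψ x y z t = Ra * θ' x y z t + lapH w x y z t
  /-- `−∂_z w = Δ_h ω` -/
  eq_w : ∀ x y z : ℝ, ∀ t ∈ D, -pz w x y z t = lapH ω x y z t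
  /-- `∂_t θ' + u ∂_x θ' + v ∂_y θ' + w ∂_z θ̄ = Δ_h θ'` -/
  eq_heat : ∀ x y z : ℝ, ∀ t ∈ D,
    pt θ' x y z t + u x y z t * px θ' x y z t + v x y z t * py θ' x y z t
      + w x y z t * deriv (fun s => θb s t) z = lapH θ' x y z t
  /-- `∂_z (mean of θ' w) = ∂²_z θ̄` -/
  eq_mean : ∀ z : ℝ, ∀ t ∈ D,
    deriv (fun s => hmean L (fun x y z' t' => θ' x y z' t' * w x y z' t') s t) z
      = deriv (deriv (fun s => θb s t)) z
  /-- `∂_x u + ∂_y v = 0` -/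
  div_free : ∀ x y z : ℝ, ∀ t ∈ D, px u x y z t + py v x y z t = 0
  /-- `ω = ∂_x v − ∂_y u` -/
  def_ω : ∀ x y z : ℝ, ∀ t ∈ D, ω x y z t = px v x y z t - py u x y z t
  /-- `Δ_h ψ = ω` -/
  def_ψ : ∀ x y z : ℝ, ∀ t ∈ D, lapH ψ x y z t = ω x y z t
  /-- `u = −∂_y ψ` -/
  def_u : ∀ x y z : ℝ, ∀ t ∈ D, u x y z t = -py ψ x y z t
  /-- `v = ∂_x ψ` -/
  def_v : ∀ x y z : ℝ, ∀ t ∈ D, v x y z t = px ψ x y z t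
  mean_θ' : ∀ z : ℝ, ∀ t ∈ D, hmean L θ' z t = 0
  mean_u : ∀ z : ℝ, ∀ t ∈ D, hmean L u z t = 0
  mean_v : ∀ z : ℝ, ∀ t ∈ D, hmean L v z t = 0
  mean_w : ∀ z : ℝ, ∀ t ∈ D, hmean L w z t = 0
  mean_ω : ∀ z : ℝ, ∀ t ∈ D, hmean L ω z t = 0
  mean_ψ : ∀ z : ℝ, ∀ t ∈ D, hmean L ψ z t = 0
  mean_θb : ∀ t ∈ D, (∫ z in (0:ℝ)..(2*π), θb z t) = 0

/-- Integral over `Ω = [0,2πL]² × [0,2π]` at time `t`. -/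
def intOmega (L : ℝ) (g : F4) (t : ℝ) : ℝ :=
  ∫ z in (0:ℝ)..(2*π), ∫ y in (0:ℝ)..(2*π*L), ∫ x in (0:ℝ)..(2*π*L), g x y z t


theorem hasDerivAt_intervalIntegral_param {F F' : ℝ → ℝ → ℝ} {U : Set ℝ} (hU : IsOpen U)
    (hF : Continuous (Function.uncurry F)) (hF' : Continuous (Function.uncurry F'))
    (h : ∀ t ∈ U, ∀ x, HasDerivAt (fun s => F s x) (F' t x) t) (a b : ℝ) {t : ℝ} (ht : t ∈ U) :
    HasDerivAt (fun s => ∫ x in a..b, F s x) (∫ x in a..b, F' t x) t := by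
  obtain ⟨ε, hε, hsub⟩ := Metric.isOpen_iff.1 hU t ht
  obtain ⟨C, hC⟩ := ((isCompact_closedBall t ε).prod
    (isCompact_uIcc (a := a) (b := b))).exists_bound_of_continuousOn hF'.continuousOn
  refine (intervalIntegral.hasDerivAt_integral_of_dominated_loc_of_deriv_le
    (s := Metric.ball t ε) (bound := fun _ => C) (Metric.ball_mem_nhds t hε) ?_ ?_ ?_ ?_ ?_ ?_).2
  · exact .of_forall fun s => (by fun_prop : Continuous (F s)).aestronglyMeasurable
  · exact (by fun_prop : Continuous (F t)).intervalIntegrable _ _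
  · exact (by fun_prop : Continuous (F' t)).aestronglyMeasurable
  · exact .of_forall fun x hx s hs =>
      hC (s, x) ⟨Metric.ball_subset_closedBall hs, Set.uIoc_subset_uIcc hx⟩
  · exact intervalIntegrable_const
  · exact .of_forall fun x _ s hs => h s (hsub hs) x

theorem integral_sq_le_of_periodic_of_mean_zero {L : ℝ} (hL : 0 < L) {f f' : ℝ → ℝ}
    (hf : ∀ x, HasDerivAt f (f' x) x) (hf' : Continuous f') (hper : f (2 * π * L) = f 0)
    (hmean : ∫ x in (0 : ℝ)..(2 * π * L), f x = 0) :
    ∫ x in (0 : ℝ)..(2 * π * L), f x ^ 2 ≤ L ^ 2 * ∫ x in (0 : ℝ)..(2 * π * L), f' x ^ 2 := by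
  have hP : (0 : ℝ) < 2 * π * L := by positivity
  have hfc : Continuous f := continuous_iff_continuousAt.2 fun x => (hf x).continuousAt
  have parseval (g : ℝ → ℝ) (hg : Continuous g) :
      HasSum (fun i => ‖fourierCoeffOn hP (fun x => (g x : ℂ)) i‖ ^ 2)
        ((2 * π * L)⁻¹ * ∫ x in (0 : ℝ)..(2 * π * L), g x ^ 2) := by
    have hgc : Continuous (fun x => (g x : ℂ)) := Complex.continuous_ofReal.comp hg
    have hb : MeasureTheory.MemLp (fun x => (g x : ℂ)) 2
        (MeasureTheory.volume.restrict (Set.Ioc 0 (2 * π * L))) := by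
      obtain ⟨C, hC⟩ := (isCompact_Icc (a := 0) (b := 2 * π * L)).exists_bound_of_continuousOn
        hgc.continuousOn
      refine MeasureTheory.MemLp.of_bound hgc.aestronglyMeasurable C ?_
      exact (MeasureTheory.ae_restrict_mem measurableSet_Ioc).mono
        fun x hx => hC x (Set.Ioc_subset_Icc_self hx)
    simpa using hasSum_sq_fourierCoeffOn hP hb
  have key := hasSum_le (fun i => ?_) (parseval f hfc) ((parseval f' hf').mul_left (L ^ 2))
  · rw [mul_left_comm] at key
    exact le_of_mul_le_mul_left key (inv_pos.2 hP)
  · by_cases hi : i = 0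
    · subst hi
      rw [fourierCoeffOn_eq_integral]
      simp only [neg_zero, fourier_zero, one_smul, intervalIntegral.integral_ofReal, hmean]
      simp only [Complex.ofReal_zero, smul_zero, norm_zero, zero_pow two_ne_zero]
      exact mul_nonneg (sq_nonneg L) (sq_nonneg _)
    · rw [fourierCoeffOn_of_hasDerivAt hP hi (fun x _ => (hf x).ofReal_comp)
        ((Complex.continuous_ofReal.comp hf').intervalIntegrable _ _), hper, sub_self, mul_zero,
        zero_sub, norm_mul, norm_neg, norm_mul, mul_pow, mul_pow, ← mul_assoc]
      refine mul_le_mul_of_nonneg_right ?_ (sq_nonneg _)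
      rw [← mul_pow]
      refine pow_le_pow_left₀ (by positivity) ?_ 2
      have h1 : (1 : ℝ) ≤ |(i : ℝ)| := by exact_mod_cast Int.one_le_abs hi
      have h2 : ‖((2 * π * L : ℝ) : ℂ) - ((0 : ℝ) : ℂ)‖ = 2 * π * L := by
        rw [← Complex.ofReal_sub, Complex.norm_real, sub_zero, Real.norm_of_nonneg hP.le]
      have h3 : ‖(1 : ℂ) / (-2 * π * Complex.I * i)‖ = 1 / (2 * π * |(i : ℝ)|) := by
        simp [abs_of_pos pi_pos]
      rw [h2, h3, div_mul_eq_mul_div, one_mul, div_le_iff₀ (by positivity)]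
      nlinarith [hP]

theorem integral_integral_dx_eq_zero {g gx : ℝ → ℝ → ℝ} {P : ℝ}
    (hg : ∀ x y, HasDerivAt (fun s => g s y) (gx x y) x)
    (hgx : Continuous (Function.uncurry gx)) (hper : ∀ y, g P y = g 0 y) :
    ∫ y in (0 : ℝ)..P, ∫ x in (0 : ℝ)..P, gx x y = 0 := by
  have (y : ℝ) : ∫ x in (0 : ℝ)..P, gx x y = 0 := by
    rw [intervalIntegral.integral_eq_sub_of_hasDerivAt (fun x _ => hg x y)
      (Continuous.intervalIntegrable (by fun_prop) _ _), hper, sub_self]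
  simp [this]

theorem intervalIntegral_swap_of_continuous {g : ℝ → ℝ → ℝ}
    (hg : Continuous (Function.uncurry g)) (a b c d : ℝ) :
    ∫ y in a..b, ∫ x in c..d, g x y = ∫ x in c..d, ∫ y in a..b, g x y := by
  refine MeasureTheory.intervalIntegral_intervalIntegral_swap (F := fun y x => g x y) ?_
  have hc : Continuous (Function.uncurry fun y x => g x y) := by fun_prop
  exact (hc.continuousOn.integrableOn_compact (isCompact_uIcc.prod isCompact_uIcc)).mono_set
    (Set.prod_mono Set.uIoc_subset_uIcc Set.uIoc_subset_uIcc)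

theorem integral_integral_dy_eq_zero {g gy : ℝ → ℝ → ℝ} {P : ℝ}
    (hg : ∀ x y, HasDerivAt (fun s => g x s) (gy x y) y)
    (hgy : Continuous (Function.uncurry gy)) (hper : ∀ x, g x P = g x 0) :
    ∫ y in (0 : ℝ)..P, ∫ x in (0 : ℝ)..P, gy x y = 0 := by
  rw [intervalIntegral_swap_of_continuous hgy]
  exact integral_integral_dx_eq_zero (g := fun y x => g x y) (gx := fun y x => gy x y)
    (fun y x => hg x y) (by fun_prop) hper

theorem integral_sub_mean_sq {g : ℝ → ℝ} (hg : Continuous g) {P : ℝ} (hP : P ≠ 0) :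
    ∫ x in (0 : ℝ)..P, (g x - (∫ s in (0 : ℝ)..P, g s) / P) ^ 2
      = (∫ x in (0 : ℝ)..P, g x ^ 2) - (∫ x in (0 : ℝ)..P, g x) ^ 2 / P := by
  set M := ∫ s in (0 : ℝ)..P, g s with hM
  have (x : ℝ) : (g x - M / P) ^ 2 = g x ^ 2 - 2 * M / P * g x + (M / P) ^ 2 := by ring
  simp_rw [this]
  rw [intervalIntegral.integral_add (Continuous.intervalIntegrable (by fun_prop) _ _)
      (Continuous.intervalIntegrable (by fun_prop) _ _),
    intervalIntegral.integral_sub (Continuous.intervalIntegrable (by fun_prop) _ _)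
      (Continuous.intervalIntegrable (by fun_prop) _ _),
    intervalIntegral.integral_const_mul, ← hM, intervalIntegral.integral_const, smul_eq_mul]
  field_simp
  ring

theorem sq_integral_le {g : ℝ → ℝ} (hg : Continuous g) {P : ℝ} (hP : 0 < P) :
    (∫ x in (0 : ℝ)..P, g x) ^ 2 ≤ P * ∫ x in (0 : ℝ)..P, g x ^ 2 := by
  have h : 0 ≤ ∫ x in (0 : ℝ)..P, (g x - (∫ s in (0 : ℝ)..P, g s) / P) ^ 2 :=
    intervalIntegral.integral_nonneg hP.le fun x _ => sq_nonneg _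
  rw [integral_sub_mean_sq hg hP.ne', sub_nonneg, div_le_iff₀ hP] at h
  linarith

/-- Sharp Poincaré inequality on the flat torus of side `2πL`. -/
theorem torus_poincare {L : ℝ} (hL : 0 < L) {f fx fy : ℝ → ℝ → ℝ}
    (hf : Continuous (Function.uncurry f))
    (hfx : ∀ x y, HasDerivAt (fun s => f s y) (fx x y) x)
    (hfy : ∀ x y, HasDerivAt (fun s => f x s) (fy x y) y)
    (hfxc : Continuous (Function.uncurry fx)) (hfyc : Continuous (Function.uncurry fy))
    (hpx : ∀ y, f (2 * π * L) y = f 0 y) (hpy : ∀ x, f x (2 * π * L) = f x 0)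
    (hmean : ∫ y in (0 : ℝ)..(2 * π * L), ∫ x in (0 : ℝ)..(2 * π * L), f x y = 0) :
    ∫ y in (0 : ℝ)..(2 * π * L), ∫ x in (0 : ℝ)..(2 * π * L), f x y ^ 2
      ≤ L ^ 2 * ∫ y in (0 : ℝ)..(2 * π * L), ∫ x in (0 : ℝ)..(2 * π * L),
          (fx x y ^ 2 + fy x y ^ 2) := by
  have hP : (0 : ℝ) < 2 * π * L := by positivity
  set P := 2 * π * L with hPdef
  set m : ℝ → ℝ := fun y => ∫ x in (0 : ℝ)..P, f x y with hm
  have hm' (y : ℝ) : HasDerivAt m (∫ x in (0 : ℝ)..P, fy x y) y :=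
    hasDerivAt_intervalIntegral_param (F := fun y x => f x y) (F' := fun y x => fy x y)
      isOpen_univ (by fun_prop) (by fun_prop) (fun y _ x => hfy x y) 0 P (Set.mem_univ y)
  have hmc : Continuous m := continuous_iff_continuousAt.2 fun y => (hm' y).continuousAt
  have hslice (y : ℝ) : ∫ x in (0 : ℝ)..P, f x y ^ 2
      ≤ L ^ 2 * (∫ x in (0 : ℝ)..P, fx x y ^ 2) + m y ^ 2 / P := by
    have hy : Continuous fun x => f x y := by fun_prop
    have := integral_sq_le_of_periodic_of_mean_zero hL (f := fun x => f x y - m y / P)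
      (fun x => (hfx x y).sub_const _) (by fun_prop) (by rw [← hPdef, hpx]) (by
        rw [← hPdef, intervalIntegral.integral_sub (Continuous.intervalIntegrable hy _ _)
          intervalIntegrable_const, intervalIntegral.integral_const, smul_eq_mul, sub_zero,
          mul_div_cancel₀ _ hP.ne']
        exact sub_self _)
    rw [← hPdef, integral_sub_mean_sq hy hP.ne'] at this
    linarith
  have hmsq : ∫ y in (0 : ℝ)..P, m y ^ 2
      ≤ L ^ 2 * (P * ∫ y in (0 : ℝ)..P, ∫ x in (0 : ℝ)..P, fy x y ^ 2) := by
    refine (integral_sq_le_of_periodic_of_mean_zero hL hm' (by fun_prop)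
      (by simp only [hm, ← hPdef, hpy]) hmean).trans ?_
    refine mul_le_mul_of_nonneg_left ?_ (sq_nonneg L)
    rw [← intervalIntegral.integral_const_mul]
    exact intervalIntegral.integral_mono_on hP.le
      (Continuous.intervalIntegrable (by fun_prop) _ _)
      (Continuous.intervalIntegrable (by fun_prop) _ _)
      fun y _ => sq_integral_le (by fun_prop) hP
  calc ∫ y in (0 : ℝ)..P, ∫ x in (0 : ℝ)..P, f x y ^ 2
      ≤ ∫ y in (0 : ℝ)..P, (L ^ 2 * (∫ x in (0 : ℝ)..P, fx x y ^ 2) + m y ^ 2 / P) :=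
        intervalIntegral.integral_mono_on hP.le
          (Continuous.intervalIntegrable (by fun_prop) _ _)
          (Continuous.intervalIntegrable (by fun_prop) _ _) fun y _ => hslice y
    _ = L ^ 2 * (∫ y in (0 : ℝ)..P, ∫ x in (0 : ℝ)..P, fx x y ^ 2)
          + (∫ y in (0 : ℝ)..P, m y ^ 2) / P := by
        rw [intervalIntegral.integral_add (Continuous.intervalIntegrable (by fun_prop) _ _)
          (Continuous.intervalIntegrable (by fun_prop) _ _),
          intervalIntegral.integral_const_mul, intervalIntegral.integral_div]
    _ ≤ L ^ 2 * (∫ y in (0 : ℝ)..P, ∫ x in (0 : ℝ)..P, fx x y ^ 2)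
          + L ^ 2 * (∫ y in (0 : ℝ)..P, ∫ x in (0 : ℝ)..P, fy x y ^ 2) := by
        gcongr
        rw [div_le_iff₀ hP]
        linarith
    _ = _ := by
        rw [← mul_add, ← intervalIntegral.integral_add
          (Continuous.intervalIntegrable (by fun_prop) _ _)
          (Continuous.intervalIntegrable (by fun_prop) _ _)]
        congr 1
        refine intervalIntegral.integral_congr fun y _ => ?_
        exact (intervalIntegral.integral_add
          (Continuous.intervalIntegrable (by fun_prop) _ _)
          (Continuous.intervalIntegrable (by fun_prop) _ _)).symm

theorem integral_integral_add {g h : ℝ → ℝ → ℝ} (hg : Continuous (Function.uncurry g))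
    (hh : Continuous (Function.uncurry h)) (a b c d : ℝ) :
    ∫ y in a..b, ∫ x in c..d, (g x y + h x y)
      = (∫ y in a..b, ∫ x in c..d, g x y) + ∫ y in a..b, ∫ x in c..d, h x y := by
  rw [← intervalIntegral.integral_add (Continuous.intervalIntegrable (by fun_prop) _ _)
    (Continuous.intervalIntegrable (by fun_prop) _ _)]
  exact intervalIntegral.integral_congr fun y _ => intervalIntegral.integral_add
    (Continuous.intervalIntegrable (by fun_prop) _ _)
    (Continuous.intervalIntegrable (by fun_prop) _ _)

theorem integral_integral_const_mul (k : ℝ) (g : ℝ → ℝ → ℝ) (a b c d : ℝ) :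
    ∫ y in a..b, ∫ x in c..d, k * g x y = k * ∫ y in a..b, ∫ x in c..d, g x y := by
  simp_rw [intervalIntegral.integral_const_mul]

theorem integral_integral_sub {g h : ℝ → ℝ → ℝ} (hg : Continuous (Function.uncurry g))
    (hh : Continuous (Function.uncurry h)) (a b c d : ℝ) :
    ∫ y in a..b, ∫ x in c..d, (g x y - h x y)
      = (∫ y in a..b, ∫ x in c..d, g x y) - ∫ y in a..b, ∫ x in c..d, h x y := by
  have := integral_integral_add hg (h := fun x y => -1 * h x y) (by fun_prop) a b c d
  rw [integral_integral_const_mul] at this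
  simpa [sub_eq_add_neg] using this

theorem hasDerivAt_integral_integral_param {F F' : ℝ → ℝ → ℝ → ℝ} {U : Set ℝ} (hU : IsOpen U)
    (hF : Continuous fun p : (ℝ × ℝ) × ℝ => F p.1.1 p.1.2 p.2)
    (hF' : Continuous fun p : (ℝ × ℝ) × ℝ => F' p.1.1 p.1.2 p.2)
    (h : ∀ t ∈ U, ∀ y x, HasDerivAt (fun s => F s y x) (F' t y x) t)
    (a b c d : ℝ) {t : ℝ} (ht : t ∈ U) :
    HasDerivAt (fun s => ∫ y in a..b, ∫ x in c..d, F s y x)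
      (∫ y in a..b, ∫ x in c..d, F' t y x) t := by
  have hslice (G : ℝ → ℝ → ℝ → ℝ) (hG : Continuous fun p : (ℝ × ℝ) × ℝ => G p.1.1 p.1.2 p.2)
      (y : ℝ) : Continuous (Function.uncurry fun s x => G s y x) :=
    hG.comp (f := fun p : ℝ × ℝ => ((p.1, y), p.2)) (by fun_prop)
  exact hasDerivAt_intervalIntegral_param hU
    (F := fun s y => ∫ x in c..d, F s y x) (F' := fun s y => ∫ x in c..d, F' s y x)
    (intervalIntegral.continuous_parametric_intervalIntegral_of_continuous'
      (f := fun p : ℝ × ℝ => F p.1 p.2) hF c d)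
    (intervalIntegral.continuous_parametric_intervalIntegral_of_continuous'
      (f := fun p : ℝ × ℝ => F' p.1 p.2) hF' c d)
    (fun s hs y => hasDerivAt_intervalIntegral_param hU (hslice F hF y) (hslice F' hF' y)
      (fun r hr x => h r hr y x) c d hs) a b ht

theorem torus_energy_dissipation {L : ℝ} (hL : 0 < L)
    {f fx fy fxx fyy u ux v vy : ℝ → ℝ → ℝ}
    (hf : Continuous (Function.uncurry f))
    (hfx : ∀ x y, HasDerivAt (fun s => f s y) (fx x y) x)
    (hfy : ∀ x y, HasDerivAt (fun s => f x s) (fy x y) y)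
    (hfxx : ∀ x y, HasDerivAt (fun s => fx s y) (fxx x y) x)
    (hfyy : ∀ x y, HasDerivAt (fun s => fy x s) (fyy x y) y)
    (hux : ∀ x y, HasDerivAt (fun s => u s y) (ux x y) x)
    (hvy : ∀ x y, HasDerivAt (fun s => v x s) (vy x y) y)
    (hfxc : Continuous (Function.uncurry fx)) (hfyc : Continuous (Function.uncurry fy))
    (hfxxc : Continuous (Function.uncurry fxx)) (hfyyc : Continuous (Function.uncurry fyy))
    (huc : Continuous (Function.uncurry u)) (hvc : Continuous (Function.uncurry v))
    (huxc : Continuous (Function.uncurry ux)) (hvyc : Continuous (Function.uncurry vy))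
    (hpx : ∀ y, f (2 * π * L) y = f 0 y) (hpy : ∀ x, f x (2 * π * L) = f x 0)
    (hpfx : ∀ y, fx (2 * π * L) y = fx 0 y) (hpfy : ∀ x, fy x (2 * π * L) = fy x 0)
    (hpu : ∀ y, u (2 * π * L) y = u 0 y) (hpv : ∀ x, v x (2 * π * L) = v x 0)
    (hdiv : ∀ x y, ux x y + vy x y = 0)
    (hmean : ∫ y in (0 : ℝ)..(2 * π * L), ∫ x in (0 : ℝ)..(2 * π * L), f x y = 0) :
    ∫ y in (0 : ℝ)..(2 * π * L), ∫ x in (0 : ℝ)..(2 * π * L),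
        f x y * (fxx x y + fyy x y - u x y * fx x y - v x y * fy x y)
      ≤ -(1 / L ^ 2) *
        ∫ y in (0 : ℝ)..(2 * π * L), ∫ x in (0 : ℝ)..(2 * π * L), f x y ^ 2 := by
  have hpoin := torus_poincare hL hf hfx hfy hfxc hfyc hpx hpy hmean
  have hX := integral_integral_dx_eq_zero (P := 2 * π * L)
    (g := fun x y => f x y * fx x y - u x y * f x y ^ 2 / 2)
    (gx := fun x y => fx x y ^ 2 + f x y * fxx x y
      - (ux x y * f x y ^ 2 / 2 + u x y * f x y * fx x y))
    (fun x y => (((hfx x y).mul (hfxx x y)).sub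
      (((hux x y).mul ((hfx x y).pow 2)).div_const 2)).congr_deriv (by simp; ring))
    (by fun_prop) (fun y => by simp only [hpx, hpfx, hpu])
  have hY := integral_integral_dy_eq_zero (P := 2 * π * L)
    (g := fun x y => f x y * fy x y - v x y * f x y ^ 2 / 2)
    (gy := fun x y => fy x y ^ 2 + f x y * fyy x y
      - (vy x y * f x y ^ 2 / 2 + v x y * f x y * fy x y))
    (fun x y => (((hfy x y).mul (hfyy x y)).sub
      (((hvy x y).mul ((hfy x y).pow 2)).div_const 2)).congr_deriv (by simp; ring))
    (by fun_prop) (fun x => by simp only [hpy, hpfy, hpv])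
  have hsplit (x y : ℝ) : f x y * (fxx x y + fyy x y - u x y * fx x y - v x y * fy x y)
      = (fx x y ^ 2 + f x y * fxx x y - (ux x y * f x y ^ 2 / 2 + u x y * f x y * fx x y))
        + (fy x y ^ 2 + f x y * fyy x y - (vy x y * f x y ^ 2 / 2 + v x y * f x y * fy x y))
        - (fx x y ^ 2 + fy x y ^ 2) := by
    linear_combination (f x y ^ 2 / 2) * hdiv x y
  simp_rw [hsplit]
  rw [integral_integral_sub (by fun_prop) (by fun_prop),
    integral_integral_add (by fun_prop) (by fun_prop), hX, hY]
  rw [neg_mul, zero_add, zero_sub, neg_le_neg_iff, one_div, inv_mul_le_iff₀ (by positivity)]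
  exact hpoin

theorem SmoothF4.continuous_comp {f : F4} {D : Set ℝ} (hf : SmoothF4 f D) {X : Type*}
    [TopologicalSpace X] {a b c d : X → ℝ} (ha : Continuous a) (hb : Continuous b)
    (hc : Continuous c) (hd : Continuous d) (hD : ∀ q, d q ∈ D) :
    Continuous fun q => f (a q) (b q) (c q) (d q) :=
  hf.continuousOn.comp_continuous (f := fun q => (a q, b q, c q, d q)) (by fun_prop) hD

theorem SmoothF4.mono {f : F4} {D D' : Set ℝ} (hf : SmoothF4 f D) (h : D' ⊆ D) : SmoothF4 f D' :=
  ContDiffOn.mono hf fun _ hp => h hp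

theorem SmoothF4.mul {f g : F4} {D : Set ℝ} (hf : SmoothF4 f D) (hg : SmoothF4 g D) :
    SmoothF4 (fun x y z t => f x y z t * g x y z t) D :=
  ContDiffOn.mul hf hg

theorem isOpen_snd_snd_snd_mem {D : Set ℝ} (hD : IsOpen D) :
    IsOpen {p : ℝ × ℝ × ℝ × ℝ | p.2.2.2 ∈ D} :=
  hD.preimage (by fun_prop)

section Partials

variable {f : F4} {D : Set ℝ}

theorem SmoothF4.hasDerivAt_line (hD : IsOpen D) (hf : SmoothF4 f D) {e : ℝ × ℝ × ℝ × ℝ}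
    {γ : ℝ → ℝ × ℝ × ℝ × ℝ} {s : ℝ} (hs : (γ s).2.2.2 ∈ D) (hγ : HasDerivAt γ e s) :
    HasDerivAt (fun r => f (γ r).1 (γ r).2.1 (γ r).2.2.1 (γ r).2.2.2)
      (fderiv ℝ (fun p : ℝ × ℝ × ℝ × ℝ => f p.1 p.2.1 p.2.2.1 p.2.2.2) (γ s) e) s := by
  have hd : DifferentiableAt ℝ (fun p : ℝ × ℝ × ℝ × ℝ => f p.1 p.2.1 p.2.2.1 p.2.2.2) (γ s) :=
    (ContDiffOn.contDiffAt hf ((isOpen_snd_snd_snd_mem hD).mem_nhds hs)).differentiableAt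
      (by simp)
  exact hd.hasFDerivAt.comp_hasDerivAt s hγ

theorem SmoothF4.of_eq_fderiv (hD : IsOpen D) (hf : SmoothF4 f D) (e : ℝ × ℝ × ℝ × ℝ) {g : F4}
    (hg : ∀ x y z, ∀ t ∈ D, g x y z t =
      fderiv ℝ (fun p : ℝ × ℝ × ℝ × ℝ => f p.1 p.2.1 p.2.2.1 p.2.2.2) (x, y, z, t) e) :
    SmoothF4 g D := by
  have h : ContDiffOn ℝ (⊤ : ℕ∞)
      (fderiv ℝ (fun p : ℝ × ℝ × ℝ × ℝ => f p.1 p.2.1 p.2.2.1 p.2.2.2))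
      {p : ℝ × ℝ × ℝ × ℝ | p.2.2.2 ∈ D} :=
    ContDiffOn.fderiv_of_isOpen hf (isOpen_snd_snd_snd_mem hD) (by simp)
  exact (h.clm_apply contDiffOn_const).congr fun p hp => hg _ _ _ _ hp

theorem SmoothF4.hasDerivAt_px (hD : IsOpen D) (hf : SmoothF4 f D) (x y z : ℝ) {t : ℝ}
    (ht : t ∈ D) : HasDerivAt (fun s => f s y z t) (px f x y z t) x :=
  (hf.hasDerivAt_line hD (γ := fun s => (s, y, z, t)) ht
    ((hasDerivAt_id x).prodMk (hasDerivAt_const x (y, z, t)))).differentiableAt.hasDerivAt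

theorem SmoothF4.hasDerivAt_py (hD : IsOpen D) (hf : SmoothF4 f D) (x y z : ℝ) {t : ℝ}
    (ht : t ∈ D) : HasDerivAt (fun s => f x s z t) (py f x y z t) y :=
  (hf.hasDerivAt_line hD (γ := fun s => (x, s, z, t)) ht
    ((hasDerivAt_const y x).prodMk ((hasDerivAt_id y).prodMk
      (hasDerivAt_const y (z, t))))).differentiableAt.hasDerivAt

theorem SmoothF4.hasDerivAt_pz (hD : IsOpen D) (hf : SmoothF4 f D) (x y z : ℝ) {t : ℝ}
    (ht : t ∈ D) : HasDerivAt (fun s => f x y s t) (pz f x y z t) z :=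
  (hf.hasDerivAt_line hD (γ := fun s => (x, y, s, t)) ht
    ((hasDerivAt_const z x).prodMk ((hasDerivAt_const z y).prodMk
      ((hasDerivAt_id z).prodMk (hasDerivAt_const z t))))).differentiableAt.hasDerivAt

theorem SmoothF4.hasDerivAt_pt (hD : IsOpen D) (hf : SmoothF4 f D) (x y z : ℝ) {t : ℝ}
    (ht : t ∈ D) : HasDerivAt (fun s => f x y z s) (pt f x y z t) t :=
  (hf.hasDerivAt_line hD (γ := fun s => (x, y, z, s)) ht
    ((hasDerivAt_const t x).prodMk ((hasDerivAt_const t y).prodMk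
      ((hasDerivAt_const t z).prodMk (hasDerivAt_id t))))).differentiableAt.hasDerivAt

theorem SmoothF4.px (hD : IsOpen D) (hf : SmoothF4 f D) : SmoothF4 (px f) D :=
  hf.of_eq_fderiv hD _ fun x y z t ht => (hf.hasDerivAt_line hD (γ := fun s => (s, y, z, t)) ht
    ((hasDerivAt_id x).prodMk (hasDerivAt_const x (y, z, t)))).deriv

theorem SmoothF4.py (hD : IsOpen D) (hf : SmoothF4 f D) : SmoothF4 (py f) D :=
  hf.of_eq_fderiv hD _ fun x y z t ht => (hf.hasDerivAt_line hD (γ := fun s => (x, s, z, t)) ht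
    ((hasDerivAt_const y x).prodMk ((hasDerivAt_id y).prodMk
      (hasDerivAt_const y (z, t))))).deriv

theorem SmoothF4.pz (hD : IsOpen D) (hf : SmoothF4 f D) : SmoothF4 (pz f) D :=
  hf.of_eq_fderiv hD _ fun x y z t ht => (hf.hasDerivAt_line hD (γ := fun s => (x, y, s, t)) ht
    ((hasDerivAt_const z x).prodMk ((hasDerivAt_const z y).prodMk
      ((hasDerivAt_id z).prodMk (hasDerivAt_const z t))))).deriv

theorem SmoothF4.pt (hD : IsOpen D) (hf : SmoothF4 f D) : SmoothF4 (pt f) D :=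
  hf.of_eq_fderiv hD _ fun x y z t ht => (hf.hasDerivAt_line hD (γ := fun s => (x, y, z, s)) ht
    ((hasDerivAt_const t x).prodMk ((hasDerivAt_const t y).prodMk
      ((hasDerivAt_const t z).prodMk (hasDerivAt_id t))))).deriv

end Partials

theorem SmoothF4.continuousOn_intOmega {g : F4} (hg : SmoothF4 g (Set.Ici 0)) (L : ℝ) :
    ContinuousOn (intOmega L g) (Set.Ici 0) := by
  have hc : Continuous fun q : ((ℝ × ℝ) × ℝ) × ℝ => g q.2 q.1.2 q.1.1.2 (max q.1.1.1 0) :=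
    hg.continuous_comp (by fun_prop) (by fun_prop) (by fun_prop) (by fun_prop)
      fun q => Set.mem_Ici.2 (le_max_right _ _)
  have h1 : Continuous fun p : (ℝ × ℝ) × ℝ =>
      ∫ x in (0 : ℝ)..(2 * π * L), g x p.2 p.1.2 (max p.1.1 0) :=
    intervalIntegral.continuous_parametric_intervalIntegral_of_continuous' hc _ _
  have h2 : Continuous fun p : ℝ × ℝ => ∫ y in (0 : ℝ)..(2 * π * L),
      ∫ x in (0 : ℝ)..(2 * π * L), g x y p.2 (max p.1 0) :=
    intervalIntegral.continuous_parametric_intervalIntegral_of_continuous' h1 _ _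
  have hc' : Continuous fun t => ∫ z in (0 : ℝ)..(2 * π), ∫ y in (0 : ℝ)..(2 * π * L),
      ∫ x in (0 : ℝ)..(2 * π * L), g x y z (max t 0) :=
    intervalIntegral.continuous_parametric_intervalIntegral_of_continuous' h2 _ _
  exact hc'.continuousOn.congr fun t ht => by simp only [intOmega, max_eq_left (Set.mem_Ici.1 ht)]

theorem SmoothF4.hasDerivAt_intOmega {g : F4} (hg : SmoothF4 g (Set.Ioi 0)) (L : ℝ) {t : ℝ}
    (ht : 0 < t) : HasDerivAt (intOmega L g) (intOmega L (_root_.pt g) t) t := by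
  have hε : 0 < t / 2 := by positivity
  have hc {f : F4} (hf : SmoothF4 f (Set.Ioi 0)) :
      Continuous fun q : ((ℝ × ℝ) × ℝ) × ℝ => f q.2 q.1.2 q.1.1.2 (max q.1.1.1 (t / 2)) :=
    hf.continuous_comp (by fun_prop) (by fun_prop) (by fun_prop) (by fun_prop)
      fun q => Set.mem_Ioi.2 (hε.trans_le (le_max_right _ _))
  have hslice {f : F4} (hf : SmoothF4 f (Set.Ioi 0)) (z : ℝ) :
      Continuous fun q : (ℝ × ℝ) × ℝ => f q.2 q.1.2 z (max q.1.1 (t / 2)) :=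
    (hc hf).comp (f := fun q : (ℝ × ℝ) × ℝ => (((q.1.1, z), q.1.2), q.2)) (by fun_prop)
  have hplane {f : F4} (hf : SmoothF4 f (Set.Ioi 0)) :
      Continuous (Function.uncurry fun s z => ∫ y in (0 : ℝ)..(2 * π * L),
        ∫ x in (0 : ℝ)..(2 * π * L), f x y z (max s (t / 2))) :=
    intervalIntegral.continuous_parametric_intervalIntegral_of_continuous'
      (intervalIntegral.continuous_parametric_intervalIntegral_of_continuous'
        (f := fun (p : (ℝ × ℝ) × ℝ) x => f x p.2 p.1.2 (max p.1.1 (t / 2))) (hc hf) _ _) _ _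
  have hpt := hg.pt isOpen_Ioi
  have hd : ∀ s ∈ Set.Ioi (t / 2), ∀ x y z,
      HasDerivAt (fun r => g x y z (max r (t / 2))) (_root_.pt g x y z (max s (t / 2))) s := by
    intro s hs x y z
    rw [max_eq_left hs.le]
    refine (hg.hasDerivAt_pt isOpen_Ioi x y z (hε.trans hs)).congr_of_eventuallyEq ?_
    filter_upwards [isOpen_Ioi.mem_nhds hs] with r hr
    rw [max_eq_left (Set.mem_Ioi.1 hr).le]
  have hmem : t ∈ Set.Ioi (t / 2) := half_lt_self ht
  have key := hasDerivAt_intervalIntegral_param isOpen_Ioi (hplane hg) (hplane hpt)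
    (fun s hs z => hasDerivAt_integral_integral_param isOpen_Ioi (hslice hg z) (hslice hpt z)
      (fun r hr y x => hd r hr x y z) 0 (2 * π * L) 0 (2 * π * L) hs) 0 (2 * π) hmem
  rw [max_eq_left hmem.le] at key
  refine key.congr_of_eventuallyEq ?_
  filter_upwards [isOpen_Ioi.mem_nhds hmem] with r hr
  rw [max_eq_left (Set.mem_Ioi.1 hr).le, intOmega]

theorem SmoothF4.continuous_hslice {f : F4} {D : Set ℝ} (hf : SmoothF4 f D) {t : ℝ} (ht : t ∈ D) :
    Continuous fun q : (ℝ × ℝ) × ℝ => f q.2 q.1.2 q.1.1 t :=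
  hf.continuous_comp (by fun_prop) (by fun_prop) (by fun_prop) (by fun_prop) fun _ => ht

theorem SmoothF4.differentiable_hmean {g : F4} {D : Set ℝ} (hD : IsOpen D) (hg : SmoothF4 g D)
    (L : ℝ) {t : ℝ} (ht : t ∈ D) : Differentiable ℝ fun z => hmean L g z t := fun z =>
  (hasDerivAt_integral_integral_param (F := fun z y x => g x y z t) isOpen_univ
    (hg.continuous_hslice ht) ((hg.pz hD).continuous_hslice ht)
    (fun z _ y x => hg.hasDerivAt_pz hD x y z ht) _ _ _ _
    (Set.mem_univ z)).differentiableAt.const_mul _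

theorem SmoothF4.continuous_slice {f : F4} {D : Set ℝ} (hf : SmoothF4 f D) (z : ℝ) {t : ℝ}
    (ht : t ∈ D) : Continuous (Function.uncurry fun x y => f x y z t) :=
  hf.continuous_comp (a := Prod.fst) (b := Prod.snd) (c := fun _ => z) (d := fun _ => t)
    (by fun_prop) (by fun_prop) (by fun_prop) (by fun_prop) fun _ => ht

theorem SmoothF4.continuous_slice_integral {f : F4} {D : Set ℝ} (hf : SmoothF4 f D) (L : ℝ) {t : ℝ}
    (ht : t ∈ D) : Continuous fun z => ∫ y in (0 : ℝ)..(2 * π * L),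
      ∫ x in (0 : ℝ)..(2 * π * L), f x y z t := by
  have h : Continuous fun p : ℝ × ℝ => ∫ x in (0 : ℝ)..(2 * π * L), f x p.2 p.1 t :=
    intervalIntegral.continuous_parametric_intervalIntegral_of_continuous'
      (hf.continuous_hslice ht) _ _
  exact intervalIntegral.continuous_parametric_intervalIntegral_of_continuous' h _ _

theorem PeriodicF4.px_period {L : ℝ} {f : F4} (hf : PeriodicF4 L f) (y z t : ℝ) :
    px f (2 * π * L) y z t = px f 0 y z t := by
  have h := deriv_comp_add_const (fun s => f s y z t) (2 * π * L) 0
  simp only [hf.1, zero_add] at h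
  exact h.symm

theorem PeriodicF4.py_period {L : ℝ} {f : F4} (hf : PeriodicF4 L f) (x z t : ℝ) :
    py f x (2 * π * L) z t = py f x 0 z t := by
  have h := deriv_comp_add_const (fun s => f x s z t) (2 * π * L) 0
  simp only [hf.2.1, zero_add] at h
  exact h.symm

theorem PeriodicF4.x_period {L : ℝ} {f : F4} (hf : PeriodicF4 L f) (y z t : ℝ) :
    f (2 * π * L) y z t = f 0 y z t := by
  simpa using hf.1 0 y z t

theorem PeriodicF4.y_period {L : ℝ} {f : F4} (hf : PeriodicF4 L f) (x z t : ℝ) :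
    f x (2 * π * L) z t = f x 0 z t := by
  simpa using hf.2.1 x 0 z t

theorem integral_integral_eq_hmean {L : ℝ} (hL : 0 < L) (f : F4) (z t : ℝ) :
    ∫ y in (0 : ℝ)..(2 * π * L), ∫ x in (0 : ℝ)..(2 * π * L), f x y z t
      = 4 * π ^ 2 * L ^ 2 * hmean L f z t := by
  rw [hmean]
  field_simp

/-- If `∂m = ∂²b` with `b` periodic, then `m = ∂b + c`, so `∫ ∂b m = ∫ (∂b)² ≥ 0`. -/
theorem integral_deriv_mul_nonneg {b m : ℝ → ℝ} {T : ℝ} (hT : 0 ≤ T) (hb : ContDiff ℝ 2 b)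
    (hm : Differentiable ℝ m) (h : ∀ z, deriv m z = deriv (deriv b) z) (hper : b T = b 0) :
    0 ≤ ∫ z in (0 : ℝ)..T, deriv b z * m z := by
  have hb' : ContDiff ℝ 1 (deriv b) := hb.deriv'
  have hbc : Continuous (deriv b) := hb'.continuous
  have hconst (z : ℝ) : m z = deriv b z + (m 0 - deriv b 0) := by
    have := is_const_of_deriv_eq_zero (hm.sub (hb'.differentiable one_ne_zero))
      (fun z => by
        rw [deriv_sub (hm z) (hb'.differentiable one_ne_zero z), h, sub_self]) z 0
    simp only [Pi.sub_apply] at this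
    linarith
  have hzero : ∫ z in (0 : ℝ)..T, deriv b z = 0 := by
    rw [intervalIntegral.integral_eq_sub_of_hasDerivAt
      (fun z _ => (hb.differentiable two_ne_zero z).hasDerivAt)
      (hbc.intervalIntegrable _ _), hper, sub_self]
  have hsplit (z : ℝ) : deriv b z * m z
      = deriv b z ^ 2 + (m 0 - deriv b 0) * deriv b z := by
    rw [hconst z]; ring
  simp_rw [hsplit]
  rw [intervalIntegral.integral_add (Continuous.intervalIntegrable (by fun_prop) _ _)
    (Continuous.intervalIntegrable (by fun_prop) _ _), intervalIntegral.integral_const_mul,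
    hzero, mul_zero, add_zero]
  exact intervalIntegral.integral_nonneg hT fun z _ => sq_nonneg _

theorem IsSolution.integral_pt_sq_le {L Ra : ℝ} (hL : 0 < L) {θ' : F4} {θb : ℝ → ℝ → ℝ}
    {u v w ω ψ : F4} (hsol : IsSolution L Ra (Set.Ici 0) θ' θb u v w ω ψ) (z : ℝ) {t : ℝ}
    (ht : 0 < t) :
    ∫ y in (0 : ℝ)..(2 * π * L), ∫ x in (0 : ℝ)..(2 * π * L),
        pt (fun x y z s => θ' x y z s ^ 2) x y z t
      ≤ -(2 / L ^ 2) * (∫ y in (0 : ℝ)..(2 * π * L), ∫ x in (0 : ℝ)..(2 * π * L),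
          θ' x y z t ^ 2)
        - 8 * π ^ 2 * L ^ 2 * (deriv (fun s => θb s t) z *
            hmean L (fun x y z' t' => θ' x y z' t' * w x y z' t') z t) := by
  have hsub : Set.Ioi (0 : ℝ) ⊆ Set.Ici 0 := Set.Ioi_subset_Ici_self
  have ht0 : t ∈ Set.Ici (0 : ℝ) := ht.le
  have hθ := hsol.smooth_θ'.mono hsub
  have hu := hsol.smooth_u.mono hsub
  have hv := hsol.smooth_v.mono hsub
  have hw := hsol.smooth_w.mono hsub
  have hθx := hθ.px isOpen_Ioi
  have hθy := hθ.py isOpen_Ioi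
  have cθ := hθ.continuous_slice z ht
  have cu := hu.continuous_slice z ht
  have cv := hv.continuous_slice z ht
  have cw := hw.continuous_slice z ht
  have cθx := hθx.continuous_slice z ht
  have cθy := hθy.continuous_slice z ht
  have cθxx := (hθx.px isOpen_Ioi).continuous_slice z ht
  have cθyy := (hθy.py isOpen_Ioi).continuous_slice z ht
  have hmean : ∫ y in (0 : ℝ)..(2 * π * L), ∫ x in (0 : ℝ)..(2 * π * L), θ' x y z t = 0 := by
    rw [integral_integral_eq_hmean hL, hsol.mean_θ' z t ht0, mul_zero]
  have hdiss := torus_energy_dissipation hL cθ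
    (fun x y => hθ.hasDerivAt_px isOpen_Ioi x y z ht)
    (fun x y => hθ.hasDerivAt_py isOpen_Ioi x y z ht)
    (fun x y => hθx.hasDerivAt_px isOpen_Ioi x y z ht)
    (fun x y => hθy.hasDerivAt_py isOpen_Ioi x y z ht)
    (fun x y => hu.hasDerivAt_px isOpen_Ioi x y z ht)
    (fun x y => hv.hasDerivAt_py isOpen_Ioi x y z ht)
    cθx cθy cθxx cθyy cu cv
    ((hu.px isOpen_Ioi).continuous_slice z ht) ((hv.py isOpen_Ioi).continuous_slice z ht)
    (fun y => hsol.per_θ'.x_period y z t) (fun x => hsol.per_θ'.y_period x z t)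
    (fun y => hsol.per_θ'.px_period y z t) (fun x => hsol.per_θ'.py_period x z t)
    (fun y => hsol.per_u.x_period y z t) (fun x => hsol.per_v.y_period x z t)
    (fun x y => hsol.div_free x y z t ht0) hmean
  set D := deriv (fun s => θb s t) z
  have hpt (x y : ℝ) : pt (fun x y z s => θ' x y z s ^ 2) x y z t
      = 2 * (θ' x y z t * (px (px θ') x y z t + py (py θ') x y z t
          - u x y z t * px θ' x y z t - v x y z t * py θ' x y z t))
        - 2 * D * (θ' x y z t * w x y z t) := by
    have h1 : pt (fun x y z s => θ' x y z s ^ 2) x y z t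
        = 2 * θ' x y z t * pt θ' x y z t := by
      refine ((hθ.hasDerivAt_pt isOpen_Ioi x y z ht).pow 2).deriv.trans ?_
      simp
    have h2 := hsol.eq_heat x y z t ht0
    simp only [lapH] at h2
    rw [h1]
    linear_combination 2 * θ' x y z t * h2
  simp_rw [hpt]
  have cprod : Continuous (Function.uncurry fun x y => θ' x y z t * (px (px θ') x y z t
      + py (py θ') x y z t - u x y z t * px θ' x y z t - v x y z t * py θ' x y z t)) :=
    cθ.mul (((cθxx.add cθyy).sub (cu.mul cθx)).sub (cv.mul cθy))
  rw [integral_integral_sub (g := fun x y => 2 * (θ' x y z t * (px (px θ') x y z t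
        + py (py θ') x y z t - u x y z t * px θ' x y z t - v x y z t * py θ' x y z t)))
      (h := fun x y => 2 * D * (θ' x y z t * w x y z t))
      (cprod.const_mul 2) ((cθ.mul cw).const_mul (2 * D)),
    integral_integral_const_mul, integral_integral_const_mul,
    integral_integral_eq_hmean hL (fun x y z' t' => θ' x y z' t' * w x y z' t')]
  have h2 : -(2 / L ^ 2) = 2 * -(1 / L ^ 2) := by ring
  rw [h2]
  linarith

theorem IsSolution.intOmega_pt_sq_le {L Ra : ℝ} (hL : 0 < L) {θ' : F4} {θb : ℝ → ℝ → ℝ}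
    {u v w ω ψ : F4} (hsol : IsSolution L Ra (Set.Ici 0) θ' θb u v w ω ψ) {t : ℝ} (ht : 0 < t) :
    intOmega L (pt fun x y z s => θ' x y z s ^ 2) t
      ≤ -(2 / L ^ 2) * intOmega L (fun x y z s => θ' x y z s ^ 2) t := by
  have hsub : Set.Ioi (0 : ℝ) ⊆ Set.Ici 0 := Set.Ioi_subset_Ici_self
  have ht0 : t ∈ Set.Ici (0 : ℝ) := ht.le
  have hθ := hsol.smooth_θ'.mono hsub
  have hsq : SmoothF4 (fun x y z s => θ' x y z s ^ 2) (Set.Ioi 0) := ContDiffOn.pow hθ 2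
  have hb : ContDiff ℝ 2 fun s => θb s t :=
    (contDiffOn_univ.1 (hsol.smooth_θb.comp (s := Set.univ) (f := fun s => (s, t))
      (by fun_prop) fun s _ => ht0)).of_le 
      (WithTop.coe_le_coe.2 le_top)
  have hm := (hθ.mul (hsol.smooth_w.mono hsub)).differentiable_hmean isOpen_Ioi L ht
  have hnonneg := integral_deriv_mul_nonneg (T := 2 * π) (by positivity) hb hm
    (fun z => hsol.eq_mean z t ht0) (by simpa using hsol.per_θb 0 t)
  have cA := hsq.continuous_slice_integral L ht
  have cB := (hsq.pt isOpen_Ioi).continuous_slice_integral L ht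
  have cM : Continuous fun z => deriv (fun s => θb s t) z *
      hmean L (fun x y z' t' => θ' x y z' t' * w x y z' t') z t :=
    (hb.continuous_deriv (by norm_num)).mul hm.continuous
  have hmono := intervalIntegral.integral_mono_on (μ := MeasureTheory.volume)
    (a := 0) (b := 2 * π) (by positivity)
    (cB.intervalIntegrable _ _)
    (((cA.const_mul (-(2 / L ^ 2))).sub (cM.const_mul (8 * π ^ 2 * L ^ 2))).intervalIntegrable _ _)
    fun z _ => hsol.integral_pt_sq_le hL z ht
  simp only [Pi.sub_apply] at hmono
  rw [intervalIntegral.integral_sub ((cA.const_mul _).intervalIntegrable _ _)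
    ((cM.const_mul _).intervalIntegrable _ _), intervalIntegral.integral_const_mul,
    intervalIntegral.integral_const_mul] at hmono
  exact hmono.trans (sub_le_self _ (mul_nonneg (by positivity) hnonneg))

theorem le_exp_mul_of_hasDerivAt_le {E E' : ℝ → ℝ} {k : ℝ} (hc : ContinuousOn E (Set.Ici 0))
    (hE : ∀ t, 0 < t → HasDerivAt E (E' t) t) (hle : ∀ t, 0 < t → E' t ≤ -k * E t) {t : ℝ}
    (ht : 0 ≤ t) : E t ≤ Real.exp (-k * t) * E 0 := by
  have hd (s : ℝ) (hs : 0 < s) : HasDerivAt (fun s => Real.exp (k * s) * E s)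
      (Real.exp (k * s) * (k * E s + E' s)) s :=
    ((((hasDerivAt_id s).const_mul k).exp).mul (hE s hs)).congr_deriv (by simp; ring)
  have hanti : AntitoneOn (fun s => Real.exp (k * s) * E s) (Set.Ici 0) := by
    refine antitoneOn_of_deriv_nonpos (convex_Ici 0) (by fun_prop) ?_ ?_
    · rw [interior_Ici]
      exact fun s hs => (hd s hs).differentiableAt.differentiableWithinAt
    · rw [interior_Ici]
      intro s hs
      rw [(hd s hs).deriv]
      exact mul_nonpos_of_nonneg_of_nonpos (Real.exp_pos _).le (by linarith [hle s hs])
  have h := hanti (Set.mem_Ici.2 le_rfl) (Set.mem_Ici.2 ht) ht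
  simp only [mul_zero, Real.exp_zero, one_mul] at h
  rw [neg_mul, Real.exp_neg, ← div_eq_inv_mul, le_div_iff₀ (Real.exp_pos _), mul_comm]
  exact h

/-- Exponential decay of the temperature fluctuation for smooth solutions of the
infinite-Prandtl-number convection system. -/
theorem temperature_fluctuation_decay (L Ra : ℝ) (hL : 0 < L)
    (θ' : F4) (θb : ℝ → ℝ → ℝ) (u v w ω ψ : F4)
    (hsol : IsSolution L Ra (Set.Ici 0) θ' θb u v w ω ψ) :
    ∀ t : ℝ, 0 ≤ t →
      intOmega L (fun x y z s => (θ' x y z s)^2) t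
        ≤ Real.exp (-(2/L^2) * t) * intOmega L (fun x y z s => (θ' x y z s)^2) 0 := by
  intro t ht
  have hsq : SmoothF4 (fun x y z s => (θ' x y z s) ^ 2) (Set.Ici 0) :=
    ContDiffOn.pow hsol.smooth_θ' 2
  exact le_exp_mul_of_hasDerivAt_le (hsq.continuousOn_intOmega L)
    (fun s hs => (hsq.mono Set.Ioi_subset_Ici_self).hasDerivAt_intOmega L hs)
    (fun s hs => hsol.intOmega_pt_sq_le hL hs) ht
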